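/- Dual simulation pruning is complete for BGPs: let D = (O_D, E_D) be a graph database over Σ, 𝔾 a basic graph pattern, and S the largest dual simulation between G(𝔾) and D. Define the pruned database D′ = (O_D, E′) with E′ = { (o, a, o′) ∈ E_D | there exists a triple pattern (v, a, w) ∈ 𝔾 with (v, o) ∈ S and (w, o′) ∈ S }. Then ⟦𝔾⟧_{D′} = ⟦𝔾⟧_D. -/

import Mathlib

/-- A relation `S ⊆ V₁ × V₂` is a dual simulation between the edge-labeled directed
graphs `(V₁, E₁)` and `(V₂, E₂)` over the same label alphabet `L`. -/
def DualSim {V₁ V₂ L : Type*} (E₁ : Set (V₁ × L × V₁)) (E₂ : Set (V₂ × L × V₂))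
    (S : Set (V₁ × V₂)) : Prop :=
  ∀ v₁ v₂, (v₁, v₂) ∈ S →
    (∀ a w₁, (v₁, a, w₁) ∈ E₁ → ∃ w₂, (v₂, a, w₂) ∈ E₂ ∧ (w₁, w₂) ∈ S) ∧
    (∀ a u₁, (u₁, a, v₁) ∈ E₁ → ∃ u₂, (u₂, a, v₂) ∈ E₂ ∧ (u₁, u₂) ∈ S)

/-- The set of variables occurring in the triple patterns of a basic graph pattern. -/
def varsOf {𝒱 L : Type*} (G : Set (𝒱 × L × 𝒱)) : Set 𝒱 :=
  {v | ∃ a w, (v, a, w) ∈ G ∨ (w, a, v) ∈ G}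

/-- `μ` (a partial function, encoded via `Option`) is a match for the basic graph
pattern `G` in the graph database with edge relation `ED`: its domain is exactly
`varsOf G` and every triple pattern of `G` is realized as an edge of the database. -/
def IsMatch {𝒱 O L : Type*} (ED : Set (O × L × O)) (G : Set (𝒱 × L × 𝒱))
    (μ : 𝒱 → Option O) : Prop :=
  (∀ v, (∃ o, μ v = some o) ↔ v ∈ varsOf G) ∧
  ∀ v a w, (v, a, w) ∈ G → ∃ o o', μ v = some o ∧ μ w = some o' ∧ (o, a, o') ∈ ED

/-- The match `μ` viewed as a relation `{(v, μ(v)) | v ∈ dom(μ)}`. -/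
def matchRel {𝒱 O : Type*} (μ : 𝒱 → Option O) : Set (𝒱 × O) :=
  {p | μ p.1 = some p.2}

/-- Two partial functions are compatible iff they agree on their common domain. -/
def Compatible {𝒱 O : Type*} (μ₁ μ₂ : 𝒱 → Option O) : Prop :=
  ∀ v o₁ o₂, μ₁ v = some o₁ → μ₂ v = some o₂ → o₁ = o₂

/-- Union of two partial functions (left-biased; on compatible ones this is the union). -/
def munion {𝒱 O : Type*} (μ₁ μ₂ : 𝒱 → Option O) : 𝒱 → Option O :=
  fun v => (μ₁ v).orElse (fun _ => μ₂ v)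

/-- Restriction of a partial function to a set of variables. -/
noncomputable def restrictDom {𝒱 O : Type*} (μ : 𝒱 → Option O) (A : Set 𝒱) :
    𝒱 → Option O :=
  fun v => letI := Classical.dec (v ∈ A); if v ∈ A then μ v else none

/-- SPARQL conjunction (AND) semantics: compatible unions of matches. -/
def AndSem {𝒱 O L : Type*} (ED : Set (O × L × O)) (G₁ G₂ : Set (𝒱 × L × 𝒱)) :
    Set (𝒱 → Option O) :=
  {μ | ∃ μ₁ μ₂, IsMatch ED G₁ μ₁ ∧ IsMatch ED G₂ μ₂ ∧ Compatible μ₁ μ₂ ∧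
    μ = munion μ₁ μ₂}

/-- SPARQL optional (OPT) semantics: left-outer join. -/
def OptSem {𝒱 O L : Type*} (ED : Set (O × L × O)) (G₁ G₂ : Set (𝒱 × L × 𝒱)) :
    Set (𝒱 → Option O) :=
  AndSem ED G₁ G₂ ∪
    {μ | IsMatch ED G₁ μ ∧ ∀ μ', IsMatch ED G₂ μ' → ¬ Compatible μ μ'}

/-- A match, viewed as a relation, is a dual simulation. -/
theorem IsMatch.dualSim_matchRel {𝒱 O L : Type*} {ED : Set (O × L × O)}
    {G : Set (𝒱 × L × 𝒱)} {μ : 𝒱 → Option O} (h : IsMatch ED G μ) :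
    DualSim G ED (matchRel μ) := by
  intro v o hv
  refine ⟨fun a w hw => ?_, fun a u hu => ?_⟩
  · obtain ⟨p, q, hp, hq, he⟩ := h.2 v a w hw
    obtain rfl : p = o := Option.some.inj (hp.symm.trans hv)
    exact ⟨q, he, hq⟩
  · obtain ⟨p, q, hp, hq, he⟩ := h.2 u a v hu
    obtain rfl : q = o := Option.some.inj (hq.symm.trans hv)
    exact ⟨p, he, hp⟩

/-- Matches in a database are matches in any larger database. -/
theorem IsMatch.mono {𝒱 O L : Type*} {ED ED' : Set (O × L × O)} (hE : ED ⊆ ED')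
    {G : Set (𝒱 × L × 𝒱)} {μ : 𝒱 → Option O} (h : IsMatch ED G μ) :
    IsMatch ED' G μ := by
  refine ⟨h.1, fun v a w hvw => ?_⟩
  obtain ⟨o, o', ho, ho', he⟩ := h.2 v a w hvw
  exact ⟨o, o', ho, ho', hE he⟩

/-- Dual simulation pruning is complete for BGPs: restricting the database to the
edges that realize some triple pattern under the largest dual simulation preserves
the set of matches. -/
theorem pruning_complete {𝒱 O L : Type*} (ED : Set (O × L × O))
    (G : Set (𝒱 × L × 𝒱)) (hG : G.Finite) (S : Set (𝒱 × O))
    (hS : DualSim G ED S) (hmax : ∀ S', DualSim G ED S' → S' ⊆ S) :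
    {μ : 𝒱 → Option O |
      IsMatch {e ∈ ED | ∃ v w, (v, e.2.1, w) ∈ G ∧ (v, e.1) ∈ S ∧ (w, e.2.2) ∈ S}
        G μ} =
    {μ : 𝒱 → Option O | IsMatch ED G μ} := by
  ext μ
  refine ⟨fun h => IsMatch.mono (Set.sep_subset _ _) h, fun h => ⟨h.1, fun v a w hvw => ?_⟩⟩
  have hμS : matchRel μ ⊆ S := hmax _ (IsMatch.dualSim_matchRel h)
  obtain ⟨o, o', ho, ho', he⟩ := h.2 v a w hvw
  exact ⟨o, o', ho, ho', he, v, w, hvw, hμS ho, hμS ho'⟩
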